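/- For every convex body K ⊆ ℝⁿ, the asymmetry constant of K equals the infimum of Banach–Mazur distances from K to symmetric convex bodies: as(K) = inf{d_BM(K, L) : L ⊆ ℝⁿ a symmetric convex body}. -/

import Mathlib

open Set Pointwise

noncomputable section

/-- The unit cube in `ℝⁿ`. -/
def cube (n : ℕ) : Set (Fin n → ℝ) := {x | ∀ i, |x i| ≤ 1}

/-- The cross-polytope (unit ball of the `ℓ¹` norm) in `ℝⁿ`. -/
def crossPoly (n : ℕ) : Set (Fin n → ℝ) := {x | ∑ i, |x i| ≤ 1}

/-- A convex body: compact, convex, nonempty interior. -/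
def IsConvexBody {n : ℕ} (K : Set (Fin n → ℝ)) : Prop :=
  Convex ℝ K ∧ IsCompact K ∧ (interior K).Nonempty

/-- A centrally symmetric set: symmetric about some point `c`. -/
def IsSymmetricBody {n : ℕ} (L : Set (Fin n → ℝ)) : Prop :=
  ∃ c : Fin n → ℝ, L = (fun x => (2 : ℝ) • c - x) '' L

/-- The Banach–Mazur distance. -/
def bmDist {n : ℕ} (K L : Set (Fin n → ℝ)) : ℝ :=
  sInf {r : ℝ | 0 < r ∧ ∃ (T : (Fin n → ℝ) ≃ₗ[ℝ] (Fin n → ℝ)) (u v : Fin n → ℝ),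
    (fun x => x + u) '' K ⊆ ⇑T '' ((fun x => x + v) '' L) ∧
    ⇑T '' ((fun x => x + v) '' L) ⊆ r • ((fun x => x + u) '' K)}

/-- The asymmetry constant of a convex body. -/
def asymConst {n : ℕ} (K : Set (Fin n → ℝ)) : ℝ :=
  sInf {r : ℝ | 0 < r ∧ ∃ z ∈ interior K,
    (fun x => x - z) '' K ⊆ (-r) • ((fun x => x - z) '' K)}

/-- A bounded set contained in `-r` times itself is also contained in `r` times itself. -/
theorem subset_smul_of_subset_neg_smul {n : ℕ} {K : Set (Fin n → ℝ)} (hconv : Convex ℝ K)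
    (hcomp : IsCompact K) (h0 : (0 : Fin n → ℝ) ∈ K) {r : ℝ} (hr : 0 < r) (h : K ⊆ (-r) • K) :
    K ⊆ r • K := by
  rcases le_or_gt 1 r with h1 | h1
  · intro x hx
    refine ⟨r⁻¹ • x, ?_, smul_inv_smul₀ hr.ne' x⟩
    exact hconv.smul_mem_of_zero_mem h0 hx ⟨by positivity, inv_le_one_of_one_le₀ h1⟩
  · obtain ⟨x, hx, hmax⟩ := hcomp.exists_isMaxOn ⟨0, h0⟩ continuous_norm.continuousOn
    obtain ⟨y, hy, hyx⟩ := h hx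
    have hxy : ‖x‖ = r * ‖y‖ := by
      rw [← hyx]
      simp [norm_smul, abs_of_pos hr]
    have hle : ‖y‖ ≤ ‖x‖ := hmax hy
    have hx0 : ‖x‖ = 0 := by nlinarith [norm_nonneg x, norm_nonneg y]
    intro w hw
    have hw0 : w = 0 := norm_le_zero_iff.1 (hx0 ▸ hmax hw)
    exact ⟨0, h0, by simp [hw0]⟩

/-- A convex set with nonempty interior contained in a negative multiple of itself has the
origin in its interior. -/
theorem zero_mem_interior_of_subset_neg_smul {n : ℕ} {K : Set (Fin n → ℝ)} (hconv : Convex ℝ K)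
    (hint : (interior K).Nonempty) {r : ℝ} (hr : 0 < r) (h : K ⊆ (-r) • K) :
    (0 : Fin n → ℝ) ∈ interior K := by
  obtain ⟨x, hx⟩ := hint
  obtain ⟨y, hy, hyx⟩ := h (interior_subset hx)
  have := hconv.combo_interior_self_mem_interior hx hy (a := 1 / (1 + r)) (b := r / (1 + r))
    (by positivity) (by positivity) (by field_simp)
  convert this using 1
  rw [← hyx]
  module

theorem IsConvexBody.image_add {n : ℕ} {K : Set (Fin n → ℝ)} (hK : IsConvexBody K)
    (u : Fin n → ℝ) : IsConvexBody ((fun x => x + u) '' K) := by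
  obtain ⟨hconv, hcomp, hint⟩ := hK
  refine ⟨?_, hcomp.image (by fun_prop), ?_⟩
  · simpa [add_comm] using hconv.translate u
  · have := (Homeomorph.addRight u).image_interior K
    simp only [Homeomorph.coe_addRight] at this
    rw [← this]
    exact hint.image _

/-- Around an interior point `z`, a set has the origin in the interior of its translate. -/
theorem zero_mem_interior_image_sub {n : ℕ} {K : Set (Fin n → ℝ)} {z : Fin n → ℝ} :
    (0 : Fin n → ℝ) ∈ interior ((fun x => x - z) '' K) ↔ z ∈ interior K := by
  have := (Homeomorph.subRight z).image_interior K
  simp only [Homeomorph.coe_subRight] at this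
  rw [← this]
  simp [sub_eq_zero]

theorem IsCompact.exists_subset_smul {n : ℕ} {K L : Set (Fin n → ℝ)} (hK : IsCompact K)
    (hL : (0 : Fin n → ℝ) ∈ interior L) : ∃ s : ℝ, 0 < s ∧ K ⊆ s • L := by
  have hb : Bornology.IsVonNBounded ℝ K := NormedSpace.isVonNBounded_of_isBounded ℝ hK.isBounded
  obtain ⟨s, hs, h⟩ := (hb (mem_interior_iff_mem_nhds.1 hL)).exists_pos
  exact ⟨s, hs, h s (le_abs_self s)⟩

/-- The set of ratios whose infimum is the Banach–Mazur distance. -/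
def bmRatios {n : ℕ} (K L : Set (Fin n → ℝ)) : Set ℝ :=
  {r : ℝ | 0 < r ∧ ∃ (T : (Fin n → ℝ) ≃ₗ[ℝ] (Fin n → ℝ)) (u v : Fin n → ℝ),
    (fun x => x + u) '' K ⊆ ⇑T '' ((fun x => x + v) '' L) ∧
    ⇑T '' ((fun x => x + v) '' L) ⊆ r • ((fun x => x + u) '' K)}

/-- The set of ratios whose infimum is the asymmetry constant. -/
def asymRatios {n : ℕ} (K : Set (Fin n → ℝ)) : Set ℝ :=
  {r : ℝ | 0 < r ∧ ∃ z ∈ interior K,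
    (fun x => x - z) '' K ⊆ (-r) • ((fun x => x - z) '' K)}

theorem bddBelow_bmRatios {n : ℕ} (K L : Set (Fin n → ℝ)) : BddBelow (bmRatios K L) :=
  ⟨0, fun _ h => h.1.le⟩

theorem bddBelow_asymRatios {n : ℕ} (K : Set (Fin n → ℝ)) : BddBelow (asymRatios K) :=
  ⟨0, fun _ h => h.1.le⟩

theorem bmDist_nonneg {n : ℕ} (K L : Set (Fin n → ℝ)) : 0 ≤ bmDist K L :=
  Real.sInf_nonneg fun _ h => h.1.le

/-- Any two convex bodies are at finite Banach–Mazur distance. -/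
theorem bmRatios_nonempty {n : ℕ} {K L : Set (Fin n → ℝ)} (hK : IsConvexBody K)
    (hL : IsConvexBody L) : (bmRatios K L).Nonempty := by
  obtain ⟨a, ha⟩ := hK.2.2
  obtain ⟨b, hb⟩ := hL.2.2
  have hK0 := zero_mem_interior_image_sub.2 ha
  have hL0 := zero_mem_interior_image_sub.2 hb
  simp only [sub_eq_add_neg] at hK0 hL0
  obtain ⟨s, hs, hKL⟩ := (hK.image_add (-a)).2.1.exists_subset_smul hL0
  obtain ⟨t, ht, hLK⟩ := (hL.image_add (-b)).2.1.exists_subset_smul hK0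
  refine ⟨s * t, by positivity, LinearEquiv.smulOfNeZero ℝ _ s hs.ne', -a, -b, hKL, ?_⟩
  rw [mul_smul]
  exact smul_set_mono (a := s) hLK

/-- A ratio for a symmetric body is a ratio for the asymmetry constant. -/
theorem bmRatios_subset_asymRatios {n : ℕ} {K L : Set (Fin n → ℝ)} (hK : IsConvexBody K)
    (hL : IsSymmetricBody L) : bmRatios K L ⊆ asymRatios K := by
  rintro r ⟨hr, T, u, v, hKL, hLK⟩
  obtain ⟨c, hc⟩ := hL
  set z : Fin n → ℝ := (2 / (1 + r)) • T (c + v) - u with hz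
  have hsub : (fun x => x - z) '' K ⊆ (-r) • ((fun x => x - z) '' K) := by
    rintro _ ⟨x, hx, rfl⟩
    obtain ⟨_, ⟨l, hl, rfl⟩, hlx⟩ := hKL ⟨x, hx, rfl⟩
    have hl' : (2 : ℝ) • c - l ∈ L := by
      rw [hc]
      exact ⟨l, hl, rfl⟩
    obtain ⟨_, ⟨y, hy, rfl⟩, hyl⟩ := hLK ⟨_, ⟨_, hl', rfl⟩, rfl⟩
    refine ⟨_, ⟨y, hy, rfl⟩, ?_⟩
    simp only [map_add, map_sub, map_smul] at hlx hyl
    have hx' : x = T l + T v - u := by rw [hlx]; abel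
    have hy' : r • y = (2 : ℝ) • T c - T l + T v - r • u := by rw [← hyl]; module
    have hz' : (1 + r) • z = (2 : ℝ) • (T c + T v) - (1 + r) • u := by
      rw [hz, smul_sub, smul_smul, map_add]
      congr 2
      field_simp
    calc (-r) • (y - z) = (1 + r) • z - r • y - z := by module
      _ = x - z := by rw [hz', hy', hx']; module
  have hbody := hK.image_add (-z)
  simp only [← sub_eq_add_neg] at hbody
  exact ⟨hr, z, zero_mem_interior_image_sub.1
    (zero_mem_interior_of_subset_neg_smul hbody.1 hbody.2.2 hr hsub), hsub⟩

/-- Every ratio for the asymmetry constant is attained by a symmetric convex body. -/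
theorem exists_symmetric_of_mem_asymRatios {n : ℕ} {K : Set (Fin n → ℝ)} (hK : IsConvexBody K)
    {r : ℝ} (h : r ∈ asymRatios K) :
    ∃ L : Set (Fin n → ℝ), IsConvexBody L ∧ IsSymmetricBody L ∧ r ∈ bmRatios K L := by
  obtain ⟨hr, z, hz, hsub⟩ := h
  have h0 := zero_mem_interior_image_sub.2 hz
  have hbody := hK.image_add (-z)
  simp only [sub_eq_add_neg] at h0 hsub
  set M := (fun x => x + -z) '' K with hM
  have hneg : (0 : Fin n → ℝ) ∈ interior (-M) := by
    have := (Homeomorph.neg (Fin n → ℝ)).image_interior M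
    simp only [Homeomorph.coe_neg, image_neg_eq_neg] at this
    rw [← this]
    simpa using h0
  have hrM := subset_smul_of_subset_neg_smul hbody.1 hbody.2.1 (interior_subset h0) hr hsub
  refine ⟨M ∩ -M, ⟨hbody.1.inter hbody.1.neg, hbody.2.1.inter hbody.2.1.neg, 0, ?_⟩,
    ⟨0, ?_⟩, hr, LinearEquiv.smulOfNeZero ℝ _ r hr.ne', -z, 0, ?_, ?_⟩
  · rw [interior_inter]
    exact ⟨h0, hneg⟩
  · simp [inter_comm]
  · intro x hx
    obtain ⟨y, hy, hyx⟩ := hrM hx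
    obtain ⟨w, hw, hwx⟩ := hsub hx
    have hyw : -y = w := by
      apply smul_right_injective (Fin n → ℝ) hr.ne'
      simp only [neg_smul] at hwx hyx ⊢
      rw [smul_neg, hyx, ← hwx, neg_neg]
    exact ⟨y, ⟨y, ⟨hy, by simpa [hyw] using hw⟩, add_zero y⟩, hyx⟩
  · rintro _ ⟨_, ⟨y, hy, rfl⟩, rfl⟩
    exact ⟨y, hy.1, by simp⟩

theorem exists_isConvexBody_isSymmetricBody (n : ℕ) :
    ∃ L : Set (Fin n → ℝ), IsConvexBody L ∧ IsSymmetricBody L := by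
  refine ⟨Metric.closedBall 0 1, ⟨convex_closedBall 0 1, isCompact_closedBall 0 1, 0, ?_⟩, 0, ?_⟩
  · exact mem_interior_iff_mem_nhds.2 (Metric.closedBall_mem_nhds 0 one_pos)
  · simp

/-- the asymmetry constant equals the infimum of Banach–Mazur
distances to symmetric convex bodies. -/
theorem stmt12 (n : ℕ) (K : Set (Fin n → ℝ)) (hK : IsConvexBody K) :
    asymConst K =
      sInf {d : ℝ | ∃ L : Set (Fin n → ℝ),
        IsConvexBody L ∧ IsSymmetricBody L ∧ d = bmDist K L} := by
  obtain ⟨L₀, hL₀, hsymm₀⟩ := exists_isConvexBody_isSymmetricBody n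
  apply le_antisymm
  · refine le_csInf ⟨_, L₀, hL₀, hsymm₀, rfl⟩ ?_
    rintro _ ⟨L, hL, hsymm, rfl⟩
    exact csInf_le_csInf (bddBelow_asymRatios K) (bmRatios_nonempty hK hL)
      (bmRatios_subset_asymRatios hK hsymm)
  · refine le_csInf ((bmRatios_nonempty hK hL₀).mono (bmRatios_subset_asymRatios hK hsymm₀)) ?_
    intro r hr
    obtain ⟨L, hL, hsymm, hrL⟩ := exists_symmetric_of_mem_asymRatios hK hr
    refine le_trans (b := bmDist K L) (csInf_le ⟨0, ?_⟩ ⟨L, hL, hsymm, rfl⟩)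
      (csInf_le (bddBelow_bmRatios K L) hrL)
    rintro _ ⟨L', _, _, rfl⟩
    exact bmDist_nonneg K L'
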